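/- The EDSC minimizer admits the spectral representation C* = V diag(λσ_1²/(1+λσ_1²), …, λσ_r²/(1+λσ_r²)) Vᵀ, where X = UΣVᵀ is a reduced SVD of X. -/

import Mathlib

open Matrix BigOperators

/-- If `V` has orthonormal columns, matrices of the form `V diag(a) Vᵀ` multiply entrywise in `a`. -/
lemma conj_diagonal_mul_conj_diagonal {m n : Type*} [Fintype m] [Fintype n] [DecidableEq n]
    {V : Matrix m n ℝ} (hV : Vᵀ * V = 1) (a b : n → ℝ) :
    (V * diagonal a * Vᵀ) * (V * diagonal b * Vᵀ) = V * diagonal (a * b) * Vᵀ := by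
  calc (V * diagonal a * Vᵀ) * (V * diagonal b * Vᵀ)
      = V * diagonal a * (Vᵀ * V) * diagonal b * Vᵀ := by simp only [Matrix.mul_assoc]
    _ = V * diagonal (a * b) * Vᵀ := by
      rw [hV, Matrix.mul_one, Matrix.mul_assoc V, diagonal_mul_diagonal]
      rfl

/-- The Gram matrix of `U diag(σ) Vᵀ` when `U` has orthonormal columns. -/
lemma transpose_mul_self_of_svd {l m n : Type*} [Fintype l] [Fintype n]
    [DecidableEq n] {U : Matrix l n ℝ} (hU : Uᵀ * U = 1) (V : Matrix m n ℝ) (σ : n → ℝ) :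
    (U * diagonal σ * Vᵀ)ᵀ * (U * diagonal σ * Vᵀ) = V * diagonal (σ ^ 2) * Vᵀ := by
  calc (U * diagonal σ * Vᵀ)ᵀ * (U * diagonal σ * Vᵀ)
      = V * diagonal σ * (Uᵀ * U) * diagonal σ * Vᵀ := by
        simp only [transpose_mul, transpose_transpose, diagonal_transpose, Matrix.mul_assoc]
    _ = V * diagonal (σ ^ 2) * Vᵀ := by
      rw [hU, Matrix.mul_one, Matrix.mul_assoc V, diagonal_mul_diagonal, sq]
      rfl

/-- Spectral representation of the EDSC minimizer:
`C* = V diag(λσᵢ²/(1+λσᵢ²)) Vᵀ` for a reduced SVD `X = UΣVᵀ`. -/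
theorem edsc_minimizer_spectral {dX N r : ℕ}
    (X : Matrix (Fin dX) (Fin N) ℝ) (lam : ℝ) (hlam : 0 < lam)
    (U : Matrix (Fin dX) (Fin r) ℝ) (V : Matrix (Fin N) (Fin r) ℝ)
    (σ : Fin r → ℝ) (hσ : ∀ i, 0 < σ i)
    (hU : Uᵀ * U = 1) (hV : Vᵀ * V = 1)
    (hX : X = U * Matrix.diagonal σ * Vᵀ)
    (hrank : X.rank = r) :
    lam • ((1 + lam • (Xᵀ * X))⁻¹ * (Xᵀ * X)) =
      V * Matrix.diagonal (fun i => lam * (σ i) ^ 2 / (1 + lam * (σ i) ^ 2)) * Vᵀ := by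
  set e : Fin r → ℝ := fun i => lam * (σ i) ^ 2 / (1 + lam * (σ i) ^ 2) with he
  have hsmul : lam • (Xᵀ * X) = V * diagonal (lam • σ ^ 2) * Vᵀ := by
    rw [hX, transpose_mul_self_of_svd hU, diagonal_smul, Matrix.mul_smul, Matrix.smul_mul]
  have hkey : lam • σ ^ 2 - e * (lam • σ ^ 2) = e := by
    funext i
    have : 1 + lam * σ i ^ 2 ≠ 0 := by positivity
    simp only [he, Pi.sub_apply, Pi.mul_apply, Pi.smul_apply, Pi.pow_apply, smul_eq_mul]
    field_simp
    ring
  have hmul : (1 - V * diagonal e * Vᵀ) * (V * diagonal (lam • σ ^ 2) * Vᵀ)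
      = V * diagonal e * Vᵀ := by
    rw [Matrix.sub_mul, Matrix.one_mul, conj_diagonal_mul_conj_diagonal hV, ← Matrix.sub_mul,
      ← Matrix.mul_sub, diagonal_sub]
    exact congrArg (fun d => V * diagonal d * Vᵀ) hkey
  have hinv : (1 + lam • (Xᵀ * X))⁻¹ = 1 - V * diagonal e * Vᵀ := by
    apply inv_eq_left_inv
    rw [hsmul, Matrix.mul_add, hmul, Matrix.mul_one, sub_add_cancel]
  rw [hinv, ← Matrix.mul_smul, hsmul, hmul]
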